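/- arXiv:2003.04837 — 3 statements merged into one kernel-verified Lean document; each statement's English description precedes it below -/
import Mathlib

section
/- Suppose a point (x₁, x₂, x₃, r₁, r₂, r₃) satisfies F = 0 together with the local-immunodeficiency pattern x₂ = 0, r₁ = 0, x₁ > 0, x₃ > 0, r₂ > 0, r₃ > 0. Then necessarily r₂ = f₁/(pβ), r₃ = (f₃ − f₁)/p (in particular f₃ > f₁), x₁ = (b/c)r₂(1 − α), and x₃ = (b/c)(α r₂ + r₃). Hence the fixed point with this pattern is unique. -/
/-- The vector field of the viral evolution model on the symmetric 3-node
cross-immunoreactivity network (node 1 → node 2 ← node 3), in the variables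
`(x₁, x₂, x₃, r₁, r₂, r₃) = (v 0, v 1, v 2, v 3, v 4, v 5)`. -/
noncomputable def F (p c b f₁ f₂ f₃ α β : ℝ) (v : Fin 6 → ℝ) : Fin 6 → ℝ :=
  ![f₁ * v 0 - p * v 0 * (v 3 + β * v 4),
    f₂ * v 1 - p * v 1 * v 4,
    f₃ * v 2 - p * v 2 * (β * v 4 + v 5),
    c * v 0 * v 3 / (v 3 + α * v 4) - b * v 3,
    c * (α * v 0 * v 4 / (v 3 + α * v 4) + v 1 + α * v 2 * v 4 / (α * v 4 + v 5)) - b * v 4,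
    c * v 2 * v 5 / (α * v 4 + v 5) - b * v 5]

/-- Any fixed point of `F` with the local-immunodeficiency pattern
`x₂ = 0, r₁ = 0, x₁ > 0, x₃ > 0, r₂ > 0, r₃ > 0` necessarily has
`r₂ = f₁/(pβ)`, `r₃ = (f₃ − f₁)/p` (so `f₃ > f₁`), `x₁ = (b/c)r₂(1−α)`
and `x₃ = (b/c)(αr₂ + r₃)`; hence the fixed point with this pattern is unique. -/
theorem stmt1 (p c b f₁ f₂ f₃ α β : ℝ)
    (hp : 0 < p) (hc : 0 < c) (hb : 0 < b)
    (hf₁ : 0 < f₁) (hf₂ : 0 < f₂) (hf₃ : 0 < f₃)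
    (hβ : 0 < β) (hβα : β < α) (hα : α < 1)
    (v : Fin 6 → ℝ)
    (hF : F p c b f₁ f₂ f₃ α β v = 0)
    (hx₂ : v 1 = 0) (hr₁ : v 3 = 0)
    (hx₁ : 0 < v 0) (hx₃ : 0 < v 2) (hr₂ : 0 < v 4) (hr₃ : 0 < v 5) :
    v 4 = f₁ / (p * β) ∧ v 5 = (f₃ - f₁) / p ∧ f₁ < f₃ ∧
    v 0 = b / c * (f₁ / (p * β)) * (1 - α) ∧
    v 2 = b / c * (α * (f₁ / (p * β)) + (f₃ - f₁) / p) := by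
  have hα0 : 0 < α := hβ.trans hβα
  have e0 := congrFun hF 0
  have e2 := congrFun hF 2
  have e4 := congrFun hF 4
  have e5 := congrFun hF 5
  simp [F] at e0 e2 e4 e5
  rw [hr₁] at e0 e4
  rw [hx₂] at e4
  generalize v 0 = x at *
  generalize v 2 = z at *
  generalize v 4 = r at *
  generalize v 5 = s at *
  have hD : 0 < α * r + s := by positivity
  have a0 : f₁ = p * β * r := by
    apply mul_left_cancel₀ hx₁.ne'
    linarith
  have a2 : f₃ = p * (β * r + s) := by
    apply mul_left_cancel₀ hx₃.ne'
    linarith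
  have a5 : c * z = b * (α * r + s) := by
    field_simp at e5
    apply mul_left_cancel₀ hr₃.ne'
    linear_combination e5
  have q1 : α * x * r / (0 + α * r) = x := by
    field_simp
    try simp
  have q2 : c * (α * z * r / (α * r + s)) = b * α * r := by
    field_simp
    linear_combination a5
  rw [q1] at e4
  have a4 : c * x = b * r * (1 - α) := by linear_combination e4 - q2
  have b0 : f₁ / (p * β) = r := by rw [a0]; field_simp
  have b2 : (f₃ - f₁) / p = s := by rw [a0, a2]; field_simp; ring
  rw [b0, b2]
  refine ⟨rfl, rfl, ?_, ?_, ?_⟩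
  · rw [a0, a2]; nlinarith [mul_pos hp hr₃]
  · field_simp; linear_combination a4
  · field_simp; linear_combination a5
end

section
/- Let J be the 6×6 Jacobian matrix of F at the equilibrium q (the matrix of partial derivatives of F evaluated at q). Set λ₁ = f₂ − f₁/β, λ₂ = b/α − 2b, and let P(λ) = αbf₁λ² + bf₁(1−α)(λ² + (b r₃/(α r₂ + r₃))λ + b p r₃) + λ²(λ + b)(λ + b r₃(1−α)/(α r₂ + r₃)) + p x₃ λ[(c r₃/(α r₂ + r₃))λ + b c r₃(1−α)/(α r₂ + r₃)], where r₂, r₃, x₃ are the coordinates of q. Then for every real λ, det(J − λ·I) = (λ − λ₁)(λ − λ₂)P(λ). -/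
/-- The coordinates `r₂`, `r₃`, `x₃` of the local-immunodeficiency equilibrium. -/
noncomputable def r₂v (p f₁ β : ℝ) : ℝ := f₁ / (p * β)
noncomputable def r₃v (p f₁ f₃ : ℝ) : ℝ := (f₃ - f₁) / p
noncomputable def x₃v (p c b f₁ f₃ α β : ℝ) : ℝ :=
  b / c * (α * r₂v p f₁ β + r₃v p f₁ f₃)

/-- The local-immunodeficiency equilibrium `q`. -/
noncomputable def q (p c b f₁ f₃ α β : ℝ) : Fin 6 → ℝ :=
  ![b / c * r₂v p f₁ β * (1 - α), 0, x₃v p c b f₁ f₃ α β,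
    0, r₂v p f₁ β, r₃v p f₁ f₃]

/-- The Jacobian matrix (matrix of partial derivatives) of a vector field at a point. -/
noncomputable def jacobianMat {ι : Type*} [Fintype ι] [DecidableEq ι]
    (G : (ι → ℝ) → ι → ℝ) (y : ι → ℝ) : Matrix ι ι ℝ :=
  Matrix.of fun i j => fderiv ℝ (fun v => G v i) y (Pi.single j 1)

/-- The quartic factor `P(λ)` of the characteristic polynomial. -/
noncomputable def P (p c b f₁ f₃ α β lam : ℝ) : ℝ :=
  α * b * f₁ * lam ^ 2
    + b * f₁ * (1 - α) *
        (lam ^ 2 + b * r₃v p f₁ f₃ / (α * r₂v p f₁ β + r₃v p f₁ f₃) * lam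
          + b * p * r₃v p f₁ f₃)
    + lam ^ 2 * (lam + b) *
        (lam + b * r₃v p f₁ f₃ * (1 - α) / (α * r₂v p f₁ β + r₃v p f₁ f₃))
    + p * x₃v p c b f₁ f₃ α β * lam *
        (c * r₃v p f₁ f₃ / (α * r₂v p f₁ β + r₃v p f₁ f₃) * lam
          + b * c * r₃v p f₁ f₃ * (1 - α) / (α * r₂v p f₁ β + r₃v p f₁ f₃))

lemma prj (v : Fin 6 → ℝ) (k : Fin 6) :
    HasFDerivAt (fun v : Fin 6 → ℝ => v k) (ContinuousLinearMap.proj (R := ℝ) (φ := fun _ : Fin 6 => ℝ) k) v :=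
  hasFDerivAt_apply k v

lemma jac_eq (p c b f₁ f₂ f₃ α β : ℝ) (x1 x3 r2 r3 : ℝ) (h2 : α * r2 ≠ 0) (hD : α * r2 + r3 ≠ 0) :
    jacobianMat (F p c b f₁ f₂ f₃ α β) ![x1, 0, x3, 0, r2, r3] =
    !![f₁ - p * (β * r2), 0, 0, -p * x1, -p * β * x1, 0;
       0, f₂ - p * r2, 0, 0, 0, 0;
       0, 0, f₃ - p * (β * r2 + r3), 0, -p * β * x3, -p * x3;
       0, 0, 0, c * x1 / (α * r2) - b, 0, 0;
       c, c, c * α * r2 / (α * r2 + r3), -c * x1 / (α * r2),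
         c * α * x3 * r3 / (α * r2 + r3) ^ 2 - b, -c * α * x3 * r2 / (α * r2 + r3) ^ 2;
       0, 0, c * r3 / (α * r2 + r3), 0, -c * α * x3 * r3 / (α * r2 + r3) ^ 2,
         c * x3 * α * r2 / (α * r2 + r3) ^ 2 - b] := by
  set w : Fin 6 → ℝ := ![x1, 0, x3, 0, r2, r3] with hw
  have P0 := prj w 0
  have P1 := prj w 1
  have P2 := prj w 2
  have P3 := prj w 3
  have P4 := prj w 4
  have P5 := prj w 5
  have w0 : w 0 = x1 := rfl
  have w1 : w 1 = 0 := rfl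
  have w2 : w 2 = x3 := rfl
  have w3 : w 3 = 0 := rfl
  have w4 : w 4 = r2 := rfl
  have w5 : w 5 = r3 := rfl
  have e1 : w 3 + α * w 4 ≠ 0 := by rw [w3, w4]; simpa using h2
  have e2 : α * w 4 + w 5 ≠ 0 := by rw [w5, w4]; simpa using hD
  have hα : α ≠ 0 := left_ne_zero_of_mul h2
  have hr : r2 ≠ 0 := right_ne_zero_of_mul h2
  have D1 := P3.add (P4.const_mul α)
  have D2 := (P4.const_mul α).add P5
  have I1 := (hasDerivAt_inv e1).comp_hasFDerivAt w D1
  have I2 := (hasDerivAt_inv e2).comp_hasFDerivAt w D2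
  have R0 := (P0.const_mul f₁).sub ((P0.const_mul p).mul (P3.add (P4.const_mul β)))
  have R1 := (P1.const_mul f₂).sub ((P1.const_mul p).mul P4)
  have R2 := (P2.const_mul f₃).sub ((P2.const_mul p).mul ((P4.const_mul β).add P5))
  have R3 := (((P0.const_mul c).mul P3).mul I1).sub (P3.const_mul b)
  have R4 := ((((((P0.const_mul α).mul P4).mul I1).add P1).add
    (((P2.const_mul α).mul P4).mul I2)).const_mul c).sub (P4.const_mul b)
  have R5 := (((P2.const_mul c).mul P5).mul I2).sub (P5.const_mul b)
  ext i j
  fin_cases i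
  · refine (congrArg (fun L => L (Pi.single j 1)) (HasFDerivAt.fderiv (f := fun v => F p c b f₁ f₂ f₃ α β v 0) R0)).trans ?_
    fin_cases j <;> simp [w0, w1, w2, w3, w4, w5] <;> ring
  · refine (congrArg (fun L => L (Pi.single j 1)) (HasFDerivAt.fderiv (f := fun v => F p c b f₁ f₂ f₃ α β v 1) R1)).trans ?_
    fin_cases j <;> simp [w0, w1, w2, w3, w4, w5] <;> ring
  · refine (congrArg (fun L => L (Pi.single j 1)) (HasFDerivAt.fderiv (f := fun v => F p c b f₁ f₂ f₃ α β v 2) R2)).trans ?_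
    fin_cases j <;> simp [w0, w1, w2, w3, w4, w5] <;> ring
  · refine (congrArg (fun L => L (Pi.single j 1)) (HasFDerivAt.fderiv (f := fun v => F p c b f₁ f₂ f₃ α β v 3) R3)).trans ?_
    fin_cases j <;> simp [w0, w1, w2, w3, w4, w5] <;> field_simp
  · refine (congrArg (fun L => L (Pi.single j 1)) (HasFDerivAt.fderiv (f := fun v => F p c b f₁ f₂ f₃ α β v 4) R4)).trans ?_
    fin_cases j <;> simp [w0, w1, w2, w3, w4, w5] <;> field_simp <;> ring
  · refine (congrArg (fun L => L (Pi.single j 1)) (HasFDerivAt.fderiv (f := fun v => F p c b f₁ f₂ f₃ α β v 5) R5)).trans ?_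
    fin_cases j <;> simp [w0, w1, w2, w3, w4, w5] <;> field_simp <;> ring

lemma det_eq (l a d m1 m2 m3 m4 m5 e c A C a11 a12 a21 a22 : ℝ) :
    (!![0, 0, 0, m1, m2, 0;
       0, a, 0, 0, 0, 0;
       0, 0, 0, 0, m3, m4;
       0, 0, 0, d, 0, 0;
       c, e, A, m5, a11, a12;
       0, 0, C, 0, a21, a22] - l • (1 : Matrix (Fin 6) (Fin 6) ℝ)).det =
    (l - a) * (l - d) * (l ^ 2 * ((a11 - l) * (a22 - l) - a12 * a21)
      + l * (m3 * (A * (a22 - l) - a12 * C) - m4 * (A * a21 - (a11 - l) * C))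
      + c * m2 * (l * (a22 - l) + m4 * C)) := by
  have : (!![0, 0, 0, m1, m2, 0;
       0, a, 0, 0, 0, 0;
       0, 0, 0, 0, m3, m4;
       0, 0, 0, d, 0, 0;
       c, e, A, m5, a11, a12;
       0, 0, C, 0, a21, a22] - l • (1 : Matrix (Fin 6) (Fin 6) ℝ)) =
     !![-l, 0, 0, m1, m2, 0;
       0, a - l, 0, 0, 0, 0;
       0, 0, -l, 0, m3, m4;
       0, 0, 0, d - l, 0, 0;
       c, e, A, m5, a11 - l, a12;
       0, 0, C, 0, a21, a22 - l] := by
    ext i j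
    fin_cases i <;> fin_cases j <;> simp [Matrix.one_apply]
  rw [this]
  simp [Matrix.det_succ_row_zero, Fin.sum_univ_succ, Fin.succAbove]
  ring

/-- With `λ₁ = f₂ − f₁/β` and `λ₂ = b/α − 2b`, for every real `λ` the
characteristic determinant of the Jacobian `J` of `F` at `q` factors as
`det(J − λI) = (λ − λ₁)(λ − λ₂)P(λ)`. -/
theorem stmt2 (p c b f₁ f₂ f₃ α β : ℝ)
    (hp : 0 < p) (hc : 0 < c) (hb : 0 < b)
    (hf₁ : 0 < f₁) (hf₂ : 0 < f₂) (hf₃ : 0 < f₃)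
    (hβ : 0 < β) (hβα : β < α) (hα : α < 1) (h13 : f₁ < f₃) :
    ∀ lam : ℝ,
      (jacobianMat (F p c b f₁ f₂ f₃ α β) (q p c b f₁ f₃ α β)
          - lam • (1 : Matrix (Fin 6) (Fin 6) ℝ)).det =
        (lam - (f₂ - f₁ / β)) * (lam - (b / α - 2 * b)) * P p c b f₁ f₃ α β lam := by
  intro lam
  have hα0 : 0 < α := hβ.trans hβα
  have hr2 : 0 < r₂v p f₁ β := by unfold r₂v; positivity
  have hr3 : 0 < r₃v p f₁ f₃ := div_pos (by linarith) hp
  have E1 : f₁ = p * β * r₂v p f₁ β := by unfold r₂v; field_simp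
  have E3 : f₃ = f₁ + p * r₃v p f₁ f₃ := by unfold r₃v; field_simp; ring
  unfold P q x₃v
  generalize r₂v p f₁ β = r2 at *
  generalize r₃v p f₁ f₃ = r3 at *
  have hD : 0 < α * r2 + r3 := by positivity
  rw [jac_eq _ _ _ _ _ _ _ _ _ _ _ _ (by positivity) hD.ne']
  have z1 : f₁ - p * (β * r2) = 0 := by rw [E1]; ring
  have z3 : f₃ - p * (β * r2 + r3) = 0 := by rw [E3, E1]; ring
  rw [z1, z3, det_eq]
  have y1 : f₂ - p * r2 = f₂ - f₁ / β := by rw [E1]; field_simp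
  have y2 : c * (b / c * r2 * (1 - α)) / (α * r2) - b = b / α - 2 * b := by field_simp; ring
  rw [y1, y2]
  congr 1
  rw [E1]
  field_simp
  ring
end

section
/- Suppose a point (x₁, x₂, r₁, r₂) satisfies G = 0 together with x₁ > 0, x₂ > 0, r₁ = 0, r₂ > 0. Then necessarily f₁ = βf₂, r₂ = f₂/p, and x₁ + x₂ = bf₂/(cp). In particular such a local-immunodeficiency equilibrium can only exist on the codimension-one parameter subspace f₁ = βf₂, and the concentration of the persistent virus is bounded: x₁ < bf₂/(cp). -/
/-- The vector field of the viral evolution model on the 2-node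
cross-immunoreactivity network with one directed edge from node 1 (persistent)
to node 2 (neutral), in the variables `(x₁, x₂, r₁, r₂) = (v 0, v 1, v 2, v 3)`. -/
noncomputable def G (p c b f₁ f₂ α β : ℝ) (v : Fin 4 → ℝ) : Fin 4 → ℝ :=
  ![f₁ * v 0 - p * v 0 * (v 2 + β * v 3),
    f₂ * v 1 - p * v 1 * v 3,
    c * v 0 * v 2 / (v 2 + α * v 3) - b * v 2,
    c * (α * v 0 * v 3 / (v 2 + α * v 3) + v 1) - b * v 3]

/-- Any point with `G = 0`, `x₁ > 0`, `x₂ > 0`, `r₁ = 0`, `r₂ > 0` necessarily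
satisfies `f₁ = βf₂`, `r₂ = f₂/p` and `x₁ + x₂ = bf₂/(cp)`; in particular such a
local-immunodeficiency equilibrium can only exist on the codimension-one
parameter subspace `f₁ = βf₂`, and the concentration of the persistent virus is
bounded: `x₁ < bf₂/(cp)`. -/
theorem stmt6 (p c b f₁ f₂ α β : ℝ)
    (hp : 0 < p) (hc : 0 < c) (hb : 0 < b) (hf₁ : 0 < f₁) (hf₂ : 0 < f₂)
    (hβ : 0 < β) (hβα : β < α) (hα : α < 1)
    (v : Fin 4 → ℝ)
    (hG : G p c b f₁ f₂ α β v = 0)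
    (hx₁ : 0 < v 0) (hx₂ : 0 < v 1) (hr₁ : v 2 = 0) (hr₂ : 0 < v 3) :
    f₁ = β * f₂ ∧ v 3 = f₂ / p ∧ v 0 + v 1 = b * f₂ / (c * p) ∧
    v 0 < b * f₂ / (c * p) := by
  have h0 : f₁ * v 0 - p * v 0 * (v 2 + β * v 3) = 0 := congrFun hG 0
  have h1 : f₂ * v 1 - p * v 1 * v 3 = 0 := congrFun hG 1
  have h3 : c * (α * v 0 * v 3 / (v 2 + α * v 3) + v 1) - b * v 3 = 0 := congrFun hG 3
  have ha : 0 < α := hβ.trans hβα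
  rw [hr₁, zero_add] at h0 h3
  have e : α * v 0 * v 3 / (α * v 3) = v 0 := by
    field_simp
  rw [e] at h3
  have k1 : f₂ = p * v 3 := by
    apply mul_right_cancel₀ hx₂.ne'
    linarith
  have k0 : f₁ = β * f₂ := by
    apply mul_right_cancel₀ hx₁.ne'
    rw [k1]
    linarith
  have k3 : v 0 + v 1 = b * f₂ / (c * p) := by
    rw [eq_div_iff (by positivity), k1]
    linear_combination p * h3
  refine ⟨k0, ?_, k3, by linarith⟩
  rw [eq_div_iff hp.ne']
  linarith
end
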